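/- Assume the generator is human-aligned. Then for every α ∈ (0, 1/2), the portfolio contains at least one of the k*(α) highest human-ranked candidates: P(α) ∩ P*(α) ≠ ∅. -/

import Mathlib

open Finset

/-- The top-`k` set of a ranking `r` of a finite type `O`: the candidates whose
rank (position under `r`) is among the first `k`. -/
def topk {O : Type*} [Fintype O] [DecidableEq O]
    (r : Fin (Fintype.card O) ≃ O) (k : ℕ) : Finset O :=
  Finset.univ.filter (fun o => ((r.symm o : Fin (Fintype.card O)) : ℕ) < k)

/-- `kstar p r α` is the least `k ≥ 1` such that the probability mass of the
top-`k` set of the ranking `r` is at least `1 - α`. -/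
noncomputable def kstar {O : Type*} [Fintype O] [DecidableEq O]
    (p : O → ℝ) (r : Fin (Fintype.card O) ≃ O) (α : ℝ) : ℕ :=
  sInf {k : ℕ | 1 ≤ k ∧ (1 - α) ≤ ∑ o ∈ topk r k, p o}

theorem mem_topk {O : Type*} [Fintype O] [DecidableEq O]
    {r : Fin (Fintype.card O) ≃ O} {k : ℕ} {o : O} :
    o ∈ topk r k ↔ (r.symm o : ℕ) < k := by
  simp [topk]

theorem card_topk_eq_card_topk {O : Type*} [Fintype O] [DecidableEq O]
    (r s : Fin (Fintype.card O) ≃ O) (k : ℕ) : #(topk r k) = #(topk s k) :=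
  Finset.card_equiv (r.symm.trans s) fun o => by simp [mem_topk]

theorem topk_card {O : Type*} [Fintype O] [DecidableEq O]
    (r : Fin (Fintype.card O) ≃ O) : topk r (Fintype.card O) = univ := by
  ext o
  simp [mem_topk]

/-- For `0 ≤ α` the mass of the portfolio reaches the threshold `1 - α`. -/
theorem one_sub_le_sum_topk_kstar {O : Type*} [Fintype O] [DecidableEq O] [Nonempty O]
    {p : O → ℝ} (hsum : ∑ o, p o = 1) (r : Fin (Fintype.card O) ≃ O)
    {α : ℝ} (hα : 0 ≤ α) : 1 - α ≤ ∑ o ∈ topk r (kstar p r α), p o := by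
  have hne : {k : ℕ | 1 ≤ k ∧ 1 - α ≤ ∑ o ∈ topk r k, p o}.Nonempty :=
    ⟨Fintype.card O, Fintype.card_pos, by rw [topk_card, hsum]; linarith⟩
  exact (Nat.sInf_mem hne).2

/-- If `p` is antitone along `h`, any set disjoint from a top-`k` set of `h` and of the same
size carries at most as much mass. -/
theorem sum_le_sum_topk_of_disjoint {O : Type*} [Fintype O] [DecidableEq O]
    {p : O → ℝ} {h : Fin (Fintype.card O) ≃ O}
    (halign : ∀ i j : Fin (Fintype.card O), i ≤ j → p (h j) ≤ p (h i))
    {s : Finset O} {k : ℕ} (hcard : #s = #(topk h k)) (hdisj : Disjoint s (topk h k)) :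
    ∑ o ∈ s, p o ≤ ∑ o ∈ topk h k, p o := by
  let f := Finset.equivOfCardEq hcard
  rw [← Finset.sum_coe_sort s, ← Finset.sum_coe_sort (topk h k), ← f.sum_comp]
  refine Finset.sum_le_sum fun x _ => ?_
  have hx : k ≤ (h.symm x : ℕ) :=
    not_lt.mp fun hlt => Finset.disjoint_left.mp hdisj x.2 (mem_topk.mpr hlt)
  have hfx : (h.symm (f x) : ℕ) < k := mem_topk.mp (f x).2
  simpa using halign (h.symm (f x)) (h.symm x) (Fin.le_def.mpr (by lia))

/-- If the generator is human-aligned, then for every α ∈ (0, 1/2), the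
portfolio contains at least one of the k*(α) highest human-ranked candidates. -/
theorem inter_nonempty_of_generator_aligned
    (O : Type*) [Fintype O] [DecidableEq O] [Nonempty O]
    (p : O → ℝ) (hp : ∀ o, 0 ≤ p o) (hsum : ∑ o, p o = 1)
    (e h : Fin (Fintype.card O) ≃ O)
    (halign : ∀ i j : Fin (Fintype.card O), i ≤ j → p (h j) ≤ p (h i))
    (α : ℝ) (hα0 : 0 < α) (hα1 : α < 1/2) :
    (topk e (kstar p e α) ∩ topk h (kstar p e α)).Nonempty := by
  by_contra hempty
  have hdisj : Disjoint (topk e (kstar p e α)) (topk h (kstar p e α)) :=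
    Finset.disjoint_iff_inter_eq_empty.mpr (Finset.not_nonempty_iff_eq_empty.mp hempty)
  have hmass := one_sub_le_sum_topk_kstar hsum e hα0.le
  have hle := sum_le_sum_topk_of_disjoint halign (card_topk_eq_card_topk e h _) hdisj
  have htotal := Finset.sum_le_univ_sum_of_nonneg
    (s := topk e (kstar p e α) ∪ topk h (kstar p e α)) hp
  rw [Finset.sum_union hdisj, hsum] at htotal
  linarith
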